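/- arXiv:1506.02235 — 12 statements merged into one kernel-verified Lean document; each statement's English description precedes it below -/
import Mathlib

section
/- Let L: ℝ² → ℝ be a smooth (at least C³) function of the variables (x,v), and suppose the function μ(x,v) := ∂²L/∂v²(x,v) is nowhere zero (i.e. L is a regular Lagrangian). Define F(x,v) := (∂L/∂x(x,v) − v·∂²L/∂x∂v(x,v)) / μ(x,v), so that the Euler–Lagrange equation of L written in normal form is ẍ = F(x,ẋ). Then μ satisfies the Jacobi multiplier equation: for all (x,v) ∈ ℝ², v·∂μ/∂x(x,v) + ∂(μF)/∂v(x,v) = 0. -/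
theorem DifferentiableAt.hasDerivAt_prodMk_left {E : Type*} [NormedAddCommGroup E]
    [NormedSpace ℝ E] {g : ℝ × ℝ → E} {x v : ℝ} (hg : DifferentiableAt ℝ g (x, v)) :
    HasDerivAt (fun x' => g (x', v)) (fderiv ℝ g (x, v) (1, 0)) x := by
  have h : HasDerivAt (fun x' : ℝ => (x', v)) (1, 0) x :=
    (hasDerivAt_id x).prodMk (hasDerivAt_const x v)
  exact HasFDerivAt.comp_hasDerivAt x hg.hasFDerivAt h

theorem DifferentiableAt.hasDerivAt_prodMk_right {E : Type*} [NormedAddCommGroup E]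
    [NormedSpace ℝ E] {g : ℝ × ℝ → E} {x v : ℝ} (hg : DifferentiableAt ℝ g (x, v)) :
    HasDerivAt (fun v' => g (x, v')) (fderiv ℝ g (x, v) (0, 1)) v := by
  have h : HasDerivAt (fun v' : ℝ => (x, v')) (0, 1) v :=
    (hasDerivAt_const v x).prodMk (hasDerivAt_id v)
  exact HasFDerivAt.comp_hasDerivAt v hg.hasFDerivAt h

theorem deriv_fst_eq_fderiv {f : ℝ → ℝ → ℝ}
    (hf : Differentiable ℝ (fun p : ℝ × ℝ => f p.1 p.2)) (x v : ℝ) :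
    deriv (fun x' => f x' v) x = fderiv ℝ (fun p : ℝ × ℝ => f p.1 p.2) (x, v) (1, 0) :=
  (hf (x, v)).hasDerivAt_prodMk_left.deriv

theorem deriv_snd_eq_fderiv {f : ℝ → ℝ → ℝ}
    (hf : Differentiable ℝ (fun p : ℝ × ℝ => f p.1 p.2)) (x v : ℝ) :
    deriv (f x) v = fderiv ℝ (fun p : ℝ × ℝ => f p.1 p.2) (x, v) (0, 1) :=
  (hf (x, v)).hasDerivAt_prodMk_right.deriv

theorem contDiff_deriv_fst {f : ℝ → ℝ → ℝ} {m n : WithTop ℕ∞}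
    (hf : ContDiff ℝ n (fun p : ℝ × ℝ => f p.1 p.2)) (hmn : m + 1 ≤ n) :
    ContDiff ℝ m (fun p : ℝ × ℝ => deriv (fun x' => f x' p.2) p.1) := by
  have hd : Differentiable ℝ (fun p : ℝ × ℝ => f p.1 p.2) :=
    (hf.of_le (le_add_self.trans hmn)).differentiable one_ne_zero
  simp only [deriv_fst_eq_fderiv hd]
  exact (hf.fderiv_right hmn).clm_apply contDiff_const

theorem contDiff_deriv_snd {f : ℝ → ℝ → ℝ} {m n : WithTop ℕ∞}
    (hf : ContDiff ℝ n (fun p : ℝ × ℝ => f p.1 p.2)) (hmn : m + 1 ≤ n) :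
    ContDiff ℝ m (fun p : ℝ × ℝ => deriv (f p.1) p.2) := by
  have hd : Differentiable ℝ (fun p : ℝ × ℝ => f p.1 p.2) :=
    (hf.of_le (le_add_self.trans hmn)).differentiable one_ne_zero
  simp only [deriv_snd_eq_fderiv hd]
  exact (hf.fderiv_right hmn).clm_apply contDiff_const

/-- Symmetry of the mixed second partial derivatives of a C² function of two real variables. -/
theorem deriv_snd_deriv_fst_comm {f : ℝ → ℝ → ℝ}
    (hf : ContDiff ℝ 2 (fun p : ℝ × ℝ => f p.1 p.2)) (x v : ℝ) :
    deriv (fun v' => deriv (fun x' => f x' v') x) v =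
      deriv (fun x' => deriv (f x') v) x := by
  have hd : Differentiable ℝ (fun p : ℝ × ℝ => f p.1 p.2) := hf.differentiable two_ne_zero
  have hd' : Differentiable ℝ (fderiv ℝ (fun p : ℝ × ℝ => f p.1 p.2)) :=
    (hf.fderiv_right (m := 1) (by norm_num)).differentiable one_ne_zero
  have hsymm : IsSymmSndFDerivAt ℝ (fun p : ℝ × ℝ => f p.1 p.2) (x, v) :=
    hf.contDiffAt.isSymmSndFDerivAt (by simp)
  have h₁ := (hd' (x, v)).hasDerivAt_prodMk_right.clm_apply
    (hasDerivAt_const v ((1, 0) : ℝ × ℝ))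
  have h₂ := (hd' (x, v)).hasDerivAt_prodMk_left.clm_apply
    (hasDerivAt_const x ((0, 1) : ℝ × ℝ))
  simp only [deriv_fst_eq_fderiv hd, deriv_snd_eq_fderiv hd]
  refine h₁.deriv.trans (Eq.trans ?_ h₂.deriv.symm)
  simpa using hsymm.eq (0, 1) (1, 0)


/-- If `L` is a C³ regular Lagrangian (i.e. `μ = ∂²L/∂v²` is nowhere zero)
and `F = (∂L/∂x − v·∂²L/∂x∂v)/μ` is the force of its Euler–Lagrange equation in
normal form `ẍ = F(x,ẋ)`, then `μ` satisfies the Jacobi multiplier equation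
`v·∂μ/∂x + ∂(μF)/∂v = 0`. -/
theorem jacobi_multiplier_of_regular_lagrangian
    (L : ℝ → ℝ → ℝ)
    (hL : ContDiff ℝ 3 (fun p : ℝ × ℝ => L p.1 p.2))
    (μ F : ℝ → ℝ → ℝ)
    (hμ : ∀ x v : ℝ, μ x v = deriv (deriv (L x)) v)
    (hμ0 : ∀ x v : ℝ, μ x v ≠ 0)
    (hF : ∀ x v : ℝ, F x v =
      (deriv (fun x' => L x' v) x - v * deriv (fun x' => deriv (L x') v) x) / μ x v) :
    ∀ x v : ℝ,
      v * deriv (fun x' => μ x' v) x + deriv (fun v' => μ x v' * F x v') v = 0 := by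
  intro x v
  have hLv : ContDiff ℝ 2 (fun p : ℝ × ℝ => deriv (L p.1) p.2) :=
    contDiff_deriv_snd hL (by norm_num)
  have hLx : ContDiff ℝ 2 (fun p : ℝ × ℝ => deriv (fun x' => L x' p.2) p.1) :=
    contDiff_deriv_fst hL (by norm_num)
  have hLvx : ContDiff ℝ 1
      (fun p : ℝ × ℝ => deriv (fun x' => deriv (L x') p.2) p.1) :=
    contDiff_deriv_fst (f := fun x v => deriv (L x) v) hLv (by norm_num)
  have hμF : (fun v' => μ x v' * F x v') = fun v' =>
      deriv (fun x' => L x' v') x - v' * deriv (fun x' => deriv (L x') v') x := by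
    funext v'
    rw [hF, mul_div_cancel₀ _ (hμ0 x v')]
  have hA : DifferentiableAt ℝ (fun v' => deriv (fun x' => L x' v') x) v :=
    (hLx.differentiable two_ne_zero (x, v)).hasDerivAt_prodMk_right.differentiableAt
  have hB : DifferentiableAt ℝ (fun v' => deriv (fun x' => deriv (L x') v') x) v :=
    (hLvx.differentiable one_ne_zero (x, v)).hasDerivAt_prodMk_right.differentiableAt
  have hcomm : deriv (fun v' => deriv (fun x' => deriv (L x') v') x) v =
      deriv (fun x' => deriv (deriv (L x')) v) x :=
    deriv_snd_deriv_fst_comm (f := fun x v => deriv (L x) v) hLv x v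
  have hcomm' := deriv_snd_deriv_fst_comm (hL.of_le (by norm_num)) x v
  rw [hμF, deriv_fun_sub hA (differentiableAt_fun_id.fun_mul hB),
    deriv_fun_mul differentiableAt_fun_id hB, hcomm, hcomm']
  simp only [hμ, deriv_id'']
  ring
end

section
/- Let F: ℝ² → ℝ be smooth and let μ: ℝ² → ℝ be a smooth nowhere-vanishing function satisfying the Jacobi multiplier equation v·∂μ/∂x(x,v) + ∂(μF)/∂v(x,v) = 0 for all (x,v). Define L: ℝ² → ℝ by L(x,v) = ∫₀^v (∫₀^{v'} μ(x,ζ) dζ) dv' + ∫₀^x μ(ζ,0)·F(ζ,0) dζ. Then ∂²L/∂v²(x,v) = μ(x,v) for all (x,v) (so L is a regular Lagrangian), and L satisfies the Euler–Lagrange identity ∂L/∂x(x,v) − v·∂²L/∂x∂v(x,v) − F(x,v)·μ(x,v) = 0 for all (x,v), i.e. the Euler–Lagrange equation of L reproduces the ODE ẍ = F(x,ẋ). -/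
open intervalIntegral

/-- Differentiation under the interval integral sign, for an integrand that is jointly continuous
together with its partial derivative in the parameter. -/
theorem hasDerivAt_intervalIntegral_of_continuous {f f' : ℝ → ℝ → ℝ}
    (hf : Continuous fun p : ℝ × ℝ => f p.1 p.2)
    (hf' : Continuous fun p : ℝ × ℝ => f' p.1 p.2)
    (hderiv : ∀ x t, HasDerivAt (fun x' => f x' t) (f' x t) x) (a b x : ℝ) :
    HasDerivAt (fun x' => ∫ t in a..b, f x' t) (∫ t in a..b, f' x t) x := by
  obtain ⟨C, hC⟩ := ((isCompact_closedBall x 1).prod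
    (isCompact_uIcc (a := a) (b := b))).exists_bound_of_continuousOn hf'.continuousOn
  have hfx (y : ℝ) : Continuous (f y) := hf.comp (Continuous.prodMk_right y)
  have hfx' (y : ℝ) : Continuous (f' y) := hf'.comp (Continuous.prodMk_right y)
  exact (intervalIntegral.hasDerivAt_integral_of_dominated_loc_of_deriv_le
    (bound := fun _ => C) (Metric.ball_mem_nhds x one_pos)
    (.of_forall fun y => (hfx y).aestronglyMeasurable)
    ((hfx x).intervalIntegrable a b) (hfx' x).aestronglyMeasurable
    (.of_forall fun t ht y hy =>
      hC (y, t) ⟨Metric.ball_subset_closedBall hy, Set.uIoc_subset_uIcc ht⟩)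
    intervalIntegrable_const (.of_forall fun t _ y _ => hderiv y t)).2

theorem continuous_primitive_of_continuous {f : ℝ → ℝ → ℝ}
    (hf : Continuous fun p : ℝ × ℝ => f p.1 p.2) (a : ℝ) :
    Continuous fun p : ℝ × ℝ => ∫ t in a..p.2, f p.1 t :=
  intervalIntegral.continuous_parametric_intervalIntegral_of_continuous
    (f := fun (p : ℝ × ℝ) t => f p.1 t) (hf.comp (by fun_prop : Continuous
      fun q : (ℝ × ℝ) × ℝ => (q.1.1, q.2))) continuous_snd

/-- Given a smooth `F` and a smooth nowhere-vanishing Jacobi multiplier `μ`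
for the ODE `ẍ = F(x,ẋ)`, the function
`L(x,v) = ∫₀^v ∫₀^{v'} μ(x,ζ) dζ dv' + ∫₀^x μ(ζ,0)F(ζ,0) dζ`
satisfies `∂²L/∂v² = μ` (so `L` is regular) and the Euler–Lagrange identity
`∂L/∂x − v·∂²L/∂x∂v − F·μ = 0`. -/
theorem lagrangian_from_jacobi_multiplier
    (F μ : ℝ → ℝ → ℝ)
    (hF : ContDiff ℝ (⊤ : ℕ∞) (fun p : ℝ × ℝ => F p.1 p.2))
    (hμsmooth : ContDiff ℝ (⊤ : ℕ∞) (fun p : ℝ × ℝ => μ p.1 p.2))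
    (hμ0 : ∀ x v : ℝ, μ x v ≠ 0)
    (hmult : ∀ x v : ℝ,
      v * deriv (fun x' => μ x' v) x + deriv (fun v' => μ x v' * F x v') v = 0)
    (L : ℝ → ℝ → ℝ)
    (hL : ∀ x v : ℝ, L x v =
      (∫ v' in (0:ℝ)..v, ∫ ζ in (0:ℝ)..v', μ x ζ) + ∫ ζ in (0:ℝ)..x, μ ζ 0 * F ζ 0) :
    ∀ x v : ℝ,
      deriv (deriv (L x)) v = μ x v ∧
      deriv (fun x' => L x' v) x - v * deriv (fun x' => deriv (L x') v) x
        - F x v * μ x v = 0 := by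
  have hFc := hF.continuous
  have hμc := hμsmooth.continuous
  have hFd := hF.differentiable (by simp)
  have hμd := hμsmooth.differentiable (by simp)
  set D : ℝ → ℝ → ℝ := fun x v => deriv (fun x' => μ x' v) x
  have hμD (x v : ℝ) : HasDerivAt (fun x' => μ x' v) (D x v) x := by
    have : Differentiable ℝ fun x' => μ x' v :=
      hμd.comp (by fun_prop : Differentiable ℝ fun x' : ℝ => (x', v))
    exact (this x).hasDerivAt
  have hDc : Continuous fun p : ℝ × ℝ => D p.1 p.2 := by
    have h : (fun p : ℝ × ℝ => D p.1 p.2) =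
        fun p => fderiv ℝ (fun p : ℝ × ℝ => μ p.1 p.2) p (1, 0) := by
      ext ⟨x, v⟩
      exact ((hμd (x, v)).hasFDerivAt.comp_hasDerivAt x
        ((hasDerivAt_id x).prodMk (hasDerivAt_const x v))).deriv
    rw [h]
    exact (hμsmooth.continuous_fderiv (by simp)).clm_apply continuous_const
  have hμx (x : ℝ) : Continuous (μ x) := hμc.comp (Continuous.prodMk_right x)
  have hDx (x : ℝ) : Continuous (D x) := hDc.comp (Continuous.prodMk_right x)
  have hg := continuous_primitive_of_continuous hμc 0
  have hG := continuous_primitive_of_continuous hDc 0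
  have hGx (x : ℝ) : Continuous fun v => ∫ ζ in (0:ℝ)..v, D x ζ :=
    hG.comp (Continuous.prodMk_right x)
  have hdL (x : ℝ) : deriv (L x) = fun v => ∫ ζ in (0:ℝ)..v, μ x ζ := by
    ext v
    rw [funext (hL x)]
    exact (((hg.comp (Continuous.prodMk_right x)).integral_hasStrictDerivAt
      0 v).hasDerivAt.add_const _).deriv
  have hgD (x v : ℝ) : HasDerivAt (fun x' => ∫ ζ in (0:ℝ)..v, μ x' ζ)
      (∫ ζ in (0:ℝ)..v, D x ζ) x :=
    hasDerivAt_intervalIntegral_of_continuous hμc hDc hμD 0 v x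
  intro x v
  refine ⟨by rw [hdL]; exact (hμx x).deriv_integral _ 0 v, ?_⟩
  have hμF : Continuous fun ζ => μ ζ 0 * F ζ 0 :=
    (hμc.comp (Continuous.prodMk_left 0)).mul (hFc.comp (Continuous.prodMk_left 0))
  have hLx : deriv (fun x' => L x' v) x =
      (∫ v' in (0:ℝ)..v, ∫ ζ in (0:ℝ)..v', D x ζ) + μ x 0 * F x 0 := by
    simp_rw [hL]
    exact ((hasDerivAt_intervalIntegral_of_continuous hg hG hgD 0 v x).add
      (hμF.integral_hasStrictDerivAt 0 x).hasDerivAt).deriv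
  have hLxv : deriv (fun x' => deriv (L x') v) x = ∫ ζ in (0:ℝ)..v, D x ζ := by
    simp_rw [hdL]
    exact (hgD x v).deriv
  have hμFd : Differentiable ℝ fun v' => μ x v' * F x v' := by
    have hp : Differentiable ℝ fun v' : ℝ => (x, v') := by fun_prop
    exact (hμd.comp hp).mul (hFd.comp hp)
  have hE (w : ℝ) : HasDerivAt (fun w => (∫ v' in (0:ℝ)..w, ∫ ζ in (0:ℝ)..v', D x ζ)
      - w * (∫ ζ in (0:ℝ)..w, D x ζ) - μ x w * F x w) 0 w := by
    refine ((((hGx x).integral_hasStrictDerivAt 0 w).hasDerivAt.sub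
      ((hasDerivAt_id w).mul ((hDx x).integral_hasStrictDerivAt 0 w).hasDerivAt)).sub
      (hμFd w).hasDerivAt).congr_deriv ?_
    rw [id]
    linarith [hmult x w]
  have hconst := is_const_of_deriv_eq_zero (fun w => (hE w).differentiableAt)
    (fun w => (hE w).deriv) v 0
  simp only [intervalIntegral.integral_same, zero_mul] at hconst
  rw [hLx, hLxv]
  linarith
end

section
/- Let F: ℝ × (0,∞) → ℝ be smooth and let I: ℝ × (0,∞) → ℝ be a smooth first integral of the vector field Γ = v∂/∂x + F∂/∂v, i.e. v·∂I/∂x(x,v) + F(x,v)·∂I/∂v(x,v) = 0 for all x ∈ ℝ and v > 0. Define L(x,v) = v·∫₁^v I(x,ζ)/ζ² dζ for x ∈ ℝ, v > 0. Then L satisfies the Euler–Lagrange identity ∂L/∂x(x,v) − v·∂²L/∂x∂v(x,v) − F(x,v)·∂²L/∂v²(x,v) = 0 for all x ∈ ℝ, v > 0; i.e. L is a Lagrangian for the ODE ẍ = F(x,ẋ) on this region. Moreover ∂²L/∂v²(x,v) = (1/v)·∂I/∂v(x,v). -/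
open intervalIntegral

/-- A parametric integral of a function which is `C¹` on an open set containing the strip
`ℝ × [a, b]` is differentiable in the parameter. -/
theorem differentiable_intervalIntegral_of_contDiffOn {g : ℝ × ℝ → ℝ} {U : Set (ℝ × ℝ)}
    (hU : IsOpen U) (hg : ContDiffOn ℝ 1 g U) {a b : ℝ}
    (hab : ∀ x : ℝ, ∀ t ∈ Set.uIcc a b, (x, t) ∈ U) :
    Differentiable ℝ (fun x => ∫ t in a..b, g (x, t)) := by
  intro x₀
  have hcont : ∀ x, ContinuousOn (fun t => g (x, t)) (Set.uIcc a b) := fun x =>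
    hg.continuousOn.comp (by fun_prop) (fun t ht => hab x t ht)
  have hfd : ContinuousOn (fun p => fderiv ℝ g p (1, 0)) U :=
    (hg.continuousOn_fderiv_of_isOpen hU le_rfl).clm_apply continuousOn_const
  obtain ⟨C, hC⟩ := ((isCompact_Icc (a := x₀ - 1) (b := x₀ + 1)).prod
    (isCompact_uIcc (a := a) (b := b))).exists_bound_of_continuousOn
      (hfd.mono fun p hp => hab p.1 p.2 hp.2)
  refine (hasDerivAt_integral_of_dominated_loc_of_deriv_le (𝕜 := ℝ)
    (F := fun x t => g (x, t)) (F' := fun x t => fderiv ℝ g (x, t) (1, 0))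
    (bound := fun _ => C)
    (Icc_mem_nhds (sub_one_lt x₀) (lt_add_one x₀))
    (Filter.Eventually.of_forall fun x => ?_) (hcont x₀).intervalIntegrable ?_
    (Filter.Eventually.of_forall fun t ht x hx => hC (x, t) ⟨hx, Set.uIoc_subset_uIcc ht⟩)
    intervalIntegrable_const
    (Filter.Eventually.of_forall fun t ht x _ => ?_)).2.differentiableAt
  · exact ((hcont x).mono Set.uIoc_subset_uIcc).aestronglyMeasurable measurableSet_uIoc
  · exact (hfd.comp (f := fun t => (x₀, t)) (by fun_prop) (fun t ht =>
      hab x₀ t (Set.uIoc_subset_uIcc ht))).aestronglyMeasurable measurableSet_uIoc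
  · have hmem := hab x t (Set.uIoc_subset_uIcc ht)
    exact ((hg.differentiableOn one_ne_zero).differentiableAt
      (hU.mem_nhds hmem)).hasFDerivAt.comp_hasDerivAt x
        ((hasDerivAt_id x).prodMk (hasDerivAt_const x t))

/-- If `I` is a smooth first integral of `Γ = v∂ₓ + F∂ᵥ` on `ℝ × (0,∞)`,
then `L(x,v) = v·∫₁^v I(x,ζ)/ζ² dζ` is a Lagrangian for `ẍ = F(x,ẋ)` on that region,
with `∂²L/∂v² = (1/v)·∂I/∂v`. -/
theorem lagrangian_from_first_integral
    (F I : ℝ → ℝ → ℝ)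
    (hF : ContDiffOn ℝ (⊤ : ℕ∞) (fun p : ℝ × ℝ => F p.1 p.2) {p : ℝ × ℝ | 0 < p.2})
    (hI : ContDiffOn ℝ (⊤ : ℕ∞) (fun p : ℝ × ℝ => I p.1 p.2) {p : ℝ × ℝ | 0 < p.2})
    (hfirst : ∀ x v : ℝ, 0 < v →
      v * deriv (fun x' => I x' v) x + F x v * deriv (I x) v = 0)
    (L : ℝ → ℝ → ℝ)
    (hL : ∀ x v : ℝ, L x v = v * ∫ ζ in (1:ℝ)..v, I x ζ / ζ ^ 2) :
    ∀ x v : ℝ, 0 < v →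
      (deriv (fun x' => L x' v) x - v * deriv (fun x' => deriv (L x') v) x
        - F x v * deriv (deriv (L x)) v = 0) ∧
      deriv (deriv (L x)) v = (1 / v) * deriv (I x) v := by
  have hU : IsOpen {p : ℝ × ℝ | 0 < p.2} := isOpen_lt continuous_const continuous_snd
  have hdiff : ∀ x v : ℝ, 0 < v → DifferentiableAt ℝ (fun p : ℝ × ℝ => I p.1 p.2) (x, v) :=
    fun x v hv => (hI.differentiableOn (by simp)).differentiableAt (hU.mem_nhds hv)
  have hIx : ∀ x v : ℝ, 0 < v → DifferentiableAt ℝ (fun x' => I x' v) x := fun x v hv =>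
    (hdiff x v hv).comp x (f := fun x' => (x', v)) (by fun_prop)
  have hIv : ∀ x v : ℝ, 0 < v → DifferentiableAt ℝ (I x) v := fun x v hv =>
    (hdiff x v hv).comp v (f := fun v' => (x, v')) (by fun_prop)
  have hpos : ∀ v : ℝ, 0 < v → ∀ t ∈ Set.uIcc 1 v, 0 < t := fun v hv t ht =>
    (lt_min one_pos hv).trans_le ht.1
  have hg : ContDiffOn ℝ 1 (fun p : ℝ × ℝ => I p.1 p.2 / p.2 ^ 2) {p : ℝ × ℝ | 0 < p.2} :=
    (hI.of_le (by exact_mod_cast le_top)).div (by fun_prop) fun p hp => pow_ne_zero 2 (ne_of_gt hp)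
  have hJx : ∀ v : ℝ, 0 < v → Differentiable ℝ (fun x => ∫ ζ in (1:ℝ)..v, I x ζ / ζ ^ 2) :=
    fun v hv => differentiable_intervalIntegral_of_contDiffOn hU hg fun _ t ht => hpos v hv t ht
  have hcont : ∀ x : ℝ, ContinuousOn (fun ζ => I x ζ / ζ ^ 2) (Set.Ioi 0) := fun x =>
    hg.continuousOn.comp (f := fun ζ => (x, ζ)) (by fun_prop) fun _ ht => ht
  have hJv : ∀ x v : ℝ, 0 < v →
      HasDerivAt (fun v => ∫ ζ in (1:ℝ)..v, I x ζ / ζ ^ 2) (I x v / v ^ 2) v := fun x v hv =>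
    integral_hasDerivAt_right
      ((hcont x).mono fun t ht => hpos v hv t ht).intervalIntegrable
      ((hcont x).stronglyMeasurableAtFilter isOpen_Ioi v hv)
      ((hcont x).continuousAt (Ioi_mem_nhds hv))
  have hLv : ∀ x v : ℝ, 0 < v →
      deriv (L x) v = (∫ ζ in (1:ℝ)..v, I x ζ / ζ ^ 2) + I x v / v := by
    intro x v hv
    rw [show L x = fun v => v * ∫ ζ in (1:ℝ)..v, I x ζ / ζ ^ 2 from funext (hL x),
      ((hasDerivAt_id' v).fun_mul (hJv x v hv)).deriv]
    field_simp
  intro x v hv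
  have hvv : deriv (deriv (L x)) v = (1 / v) * deriv (I x) v := by
    have h : deriv (L x) =ᶠ[nhds v]
        fun v => (∫ ζ in (1:ℝ)..v, I x ζ / ζ ^ 2) + I x v / v := by
      filter_upwards [Ioi_mem_nhds hv] with w hw using hLv x w hw
    rw [h.deriv_eq, ((hJv x v hv).fun_add
      ((hIv x v hv).hasDerivAt.fun_div (hasDerivAt_id' v) hv.ne')).deriv]
    field_simp
    ring
  refine ⟨?_, hvv⟩
  have hx : deriv (fun x' => L x' v) x
      = v * deriv (fun x' => ∫ ζ in (1:ℝ)..v, I x' ζ / ζ ^ 2) x := by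
    simp only [hL]
    exact deriv_const_mul _ (hJx v hv x)
  have hxv : deriv (fun x' => deriv (L x') v) x
      = deriv (fun x' => ∫ ζ in (1:ℝ)..v, I x' ζ / ζ ^ 2) x
        + deriv (fun x' => I x' v) x / v := by
    simp only [hLv _ v hv]
    exact ((hJx v hv x).hasDerivAt.add ((hIx x v hv).hasDerivAt.div_const v)).deriv
  rw [hx, hxv, hvv]
  field_simp
  linear_combination -hfirst x v hv
end

section
/- Fix k ≥ 0 and α ∈ ℝ, and let F₁(x,v) = x(kv² − α²)/(1 + kx²) be the function defining the first nonlinear oscillator ẍ − (kx/(1+kx²))ẋ² + α²x/(1+kx²) = 0. Then μ₁(x,v) = 1/(1 + kx²) is a Jacobi multiplier for this equation: for all (x,v) ∈ ℝ², v·∂μ₁/∂x(x,v) + ∂(μ₁F₁)/∂v(x,v) = 0, and μ₁ is nowhere zero. -/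
/-- `μ₁(x,v) = 1/(1+kx²)` is a Jacobi multiplier for the first
nonlinear oscillator `ẍ = F₁(x,ẋ)`, `F₁(x,v) = x(kv² − α²)/(1+kx²)`, `k ≥ 0`. -/
theorem jacobi_multiplier_mu1_first_oscillator
    (k α : ℝ) (hk : 0 ≤ k) (F₁ μ₁ : ℝ → ℝ → ℝ)
    (hF : ∀ x v : ℝ, F₁ x v = x * (k * v ^ 2 - α ^ 2) / (1 + k * x ^ 2))
    (hμ : ∀ x v : ℝ, μ₁ x v = 1 / (1 + k * x ^ 2)) :
    (∀ x v : ℝ,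
      v * deriv (fun x' => μ₁ x' v) x + deriv (fun v' => μ₁ x v' * F₁ x v') v = 0)
    ∧ (∀ x v : ℝ, μ₁ x v ≠ 0) := by
  have hpos (x : ℝ) : 1 + k * x ^ 2 ≠ 0 := by positivity
  have hsq (y : ℝ) : HasDerivAt (fun z : ℝ => z ^ 2) (2 * y) y := by
    simpa using hasDerivAt_pow 2 y
  refine ⟨fun x v => ?_, fun x v => by rw [hμ]; exact one_div_ne_zero (hpos x)⟩
  simp only [hF, hμ]
  have hx : HasDerivAt (fun y : ℝ => 1 / (1 + k * y ^ 2))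
      (-(2 * k * x) / (1 + k * x ^ 2) ^ 2) x := by
    have hden : HasDerivAt (fun y : ℝ => 1 + k * y ^ 2) (2 * k * x) x := by
      simpa only [mul_left_comm, mul_assoc] using ((hsq x).const_mul k).const_add 1
    simpa only [one_div] using hden.fun_inv (hpos x)
  have hv : HasDerivAt
      (fun w : ℝ => 1 / (1 + k * x ^ 2) * (x * (k * w ^ 2 - α ^ 2) / (1 + k * x ^ 2)))
      (1 / (1 + k * x ^ 2) * (x * (k * (2 * v)) / (1 + k * x ^ 2))) v := by
    exact (((((hsq v).const_mul k).sub_const (α ^ 2)).const_mul x).div_const _).const_mul _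
  rw [hx.deriv, hv.deriv]
  have := hpos x
  field_simp
  ring
end

section
/- Fix k ≥ 0 and α ∈ ℝ, and let F₁(x,v) = x(kv² − α²)/(1 + kx²). Then μ₂(x,v) = 1/(kv² − α²) satisfies the Jacobi multiplier equation for the first nonlinear oscillator at every point of the open set U = {(x,v) ∈ ℝ² : kv² − α² ≠ 0}: for all (x,v) ∈ U, v·∂μ₂/∂x(x,v) + ∂(μ₂F₁)/∂v(x,v) = 0. -/
/-- `μ₂(x,v) = 1/(kv² − α²)` satisfies the Jacobi multiplier equation
for the first nonlinear oscillator `ẍ = F₁(x,ẋ)`, `F₁(x,v) = x(kv² − α²)/(1+kx²)`,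
at every point of the open set `U = {(x,v) : kv² − α² ≠ 0}`. -/
theorem jacobi_multiplier_mu2_first_oscillator
    (k α : ℝ) (hk : 0 ≤ k) (F₁ μ₂ : ℝ → ℝ → ℝ)
    (hF : ∀ x v : ℝ, F₁ x v = x * (k * v ^ 2 - α ^ 2) / (1 + k * x ^ 2))
    (hμ : ∀ x v : ℝ, μ₂ x v = 1 / (k * v ^ 2 - α ^ 2)) :
    ∀ x v : ℝ, k * v ^ 2 - α ^ 2 ≠ 0 →
      v * deriv (fun x' => μ₂ x' v) x + deriv (fun v' => μ₂ x v' * F₁ x v') v = 0 := by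
  intro x v hv
  have hx : deriv (fun x' => μ₂ x' v) x = 0 := by
    simp only [hμ, deriv_const]
  have hne : ∀ᶠ v' in nhds v, k * v' ^ 2 - α ^ 2 ≠ 0 :=
    ContinuousAt.eventually_ne (by fun_prop) hv
  have heq : (fun v' => μ₂ x v' * F₁ x v') =ᶠ[nhds v] fun _ => x / (1 + k * x ^ 2) := by
    filter_upwards [hne] with v' hv'
    rw [hμ, hF, mul_div_assoc', ← mul_assoc, mul_right_comm, one_div_mul_cancel hv', one_mul]
  rw [hx, heq.deriv_eq, deriv_const, mul_zero, add_zero]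
end

section
/- Fix k ≥ 0 and α ∈ ℝ. Let x: ℝ → ℝ be twice differentiable and satisfy the first nonlinear oscillator equation (1 + kx(t)²)·ẍ(t) = x(t)·(kẋ(t)² − α²) for all t ∈ ℝ, and assume kẋ(t)² − α² ≠ 0 for all t. Then the function t ↦ I(t) = (1 + kx(t)²)/(kẋ(t)² − α²) is constant on ℝ; i.e. I = (1+kx²)/(kv²−α²) is a constant of motion for the first nonlinear oscillator. -/
/-- Along any twice differentiable solution of the first nonlinear
oscillator `(1+kx²)ẍ = x(kẋ² − α²)` with `kẋ² − α² ≠ 0` everywhere, the quantity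
`I = (1+kx²)/(kẋ² − α²)` is constant. -/
theorem constant_of_motion_first_oscillator
    (k α : ℝ) (hk : 0 ≤ k) (x x' x'' : ℝ → ℝ)
    (hx : ∀ t : ℝ, HasDerivAt x (x' t) t)
    (hx' : ∀ t : ℝ, HasDerivAt x' (x'' t) t)
    (heq : ∀ t : ℝ, (1 + k * x t ^ 2) * x'' t = x t * (k * x' t ^ 2 - α ^ 2))
    (hne : ∀ t : ℝ, k * x' t ^ 2 - α ^ 2 ≠ 0) :
    ∀ t s : ℝ,
      (1 + k * x t ^ 2) / (k * x' t ^ 2 - α ^ 2)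
        = (1 + k * x s ^ 2) / (k * x' s ^ 2 - α ^ 2) := by
  have hderiv : ∀ t, HasDerivAt
      (fun t ↦ (1 + k * x t ^ 2) / (k * x' t ^ 2 - α ^ 2)) 0 t := by
    intro t
    have hnum := (((hx t).pow 2).const_mul k).const_add 1
    have hden := (((hx' t).pow 2).const_mul k).sub_const (α ^ 2)
    refine (hnum.div hden (hne t)).congr_deriv ?_
    rw [div_eq_zero_iff]
    left
    simp only [Pi.pow_apply]
    push_cast
    linear_combination (-2 * k * x' t) * heq t
  exact is_const_of_deriv_eq_zero (fun t ↦ (hderiv t).differentiableAt)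
    (fun t ↦ (hderiv t).deriv)
end

section
/- Fix k ≥ 0 and α ∈ ℝ, and let F₁(x,v) = x(kv² − α²)/(1 + kx²). The function L₁(x,v) = (v² − α²x²)/(2(1 + kx²)) is a regular Lagrangian for the first nonlinear oscillator: for all (x,v) ∈ ℝ², ∂L₁/∂x(x,v) − v·∂²L₁/∂x∂v(x,v) − F₁(x,v)·∂²L₁/∂v²(x,v) = 0, and ∂²L₁/∂v²(x,v) = 1/(1 + kx²) is nowhere zero. -/
/-- `L₁(x,v) = (v² − α²x²)/(2(1+kx²))` is a regular Lagrangian for the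
first nonlinear oscillator `ẍ = F₁(x,ẋ)`, `F₁(x,v) = x(kv² − α²)/(1+kx²)`, `k ≥ 0`:
the Euler–Lagrange identity holds and `∂²L₁/∂v² = 1/(1+kx²)` is nowhere zero. -/
theorem lagrangian_L1_first_oscillator
    (k α : ℝ) (hk : 0 ≤ k) (F₁ L₁ : ℝ → ℝ → ℝ)
    (hF : ∀ x v : ℝ, F₁ x v = x * (k * v ^ 2 - α ^ 2) / (1 + k * x ^ 2))
    (hL : ∀ x v : ℝ, L₁ x v = (v ^ 2 - α ^ 2 * x ^ 2) / (2 * (1 + k * x ^ 2))) :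
    ∀ x v : ℝ,
      (deriv (fun x' => L₁ x' v) x - v * deriv (fun x' => deriv (L₁ x') v) x
        - F₁ x v * deriv (deriv (L₁ x)) v = 0)
      ∧ deriv (deriv (L₁ x)) v = 1 / (1 + k * x ^ 2)
      ∧ (1 / (1 + k * x ^ 2) : ℝ) ≠ 0 := by
  have hw : ∀ x : ℝ, 1 + k * x ^ 2 ≠ 0 := fun x => by positivity
  obtain rfl : L₁ = fun x v => (v ^ 2 - α ^ 2 * x ^ 2) / (2 * (1 + k * x ^ 2)) :=
    funext fun x => funext (hL x)
  have hdw : ∀ x : ℝ, HasDerivAt (fun y => 1 + k * y ^ 2) (2 * k * x) x := fun x => by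
    refine (((hasDerivAt_pow 2 x).const_mul k).const_add 1).congr_deriv ?_
    norm_num
    ring
  have hLv : ∀ x v : ℝ, deriv (fun v => (v ^ 2 - α ^ 2 * x ^ 2) / (2 * (1 + k * x ^ 2))) v
      = v / (1 + k * x ^ 2) := fun x v => by
    rw [(((hasDerivAt_pow 2 v).sub_const _).div_const _).deriv]
    have := hw x
    norm_num
    field_simp
  intro x v
  have hLvv : deriv (deriv (fun v => (v ^ 2 - α ^ 2 * x ^ 2) / (2 * (1 + k * x ^ 2)))) v
      = 1 / (1 + k * x ^ 2) := by
    rw [funext (hLv x)]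
    exact ((hasDerivAt_id v).div_const _).deriv
  have hLvx : HasDerivAt (fun y => v / (1 + k * y ^ 2))
      (-(2 * k * x * v) / (1 + k * x ^ 2) ^ 2) x := by
    refine ((hasDerivAt_const x v).fun_div (hdw x) (hw x)).congr_deriv ?_
    ring
  have hLx : HasDerivAt (fun y => (v ^ 2 - α ^ 2 * y ^ 2) / (2 * (1 + k * y ^ 2)))
      (-(x * (k * v ^ 2 + α ^ 2)) / (1 + k * x ^ 2) ^ 2) x := by
    have hnum := ((hasDerivAt_pow 2 x).const_mul (α ^ 2)).const_sub (v ^ 2)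
    refine (hnum.fun_div ((hdw x).const_mul 2) (mul_ne_zero two_ne_zero (hw x))).congr_deriv ?_
    have := hw x
    norm_num
    field_simp
    ring
  refine ⟨?_, hLvv, one_div_ne_zero (hw x)⟩
  simp only [hLv]
  rw [hLx.deriv, hLvx.deriv, hLvv, hF]
  have := hw x
  field_simp
  ring
end

section
/- Fix k > 0 and α > 0, let F₁(x,v) = x(kv² − α²)/(1 + kx²), and consider the open set U = {(x,v) ∈ ℝ² : √k·|v| < α}. Define on U the non-mechanical Lagrangian L₂(x,v) = −(v/(√k·α))·artanh(√k·v/α) + (1/(2k))·log((1 + kx²)/(α² − kv²)). Then for all (x,v) ∈ U: (i) ∂²L₂/∂v²(x,v) = 1/(kv² − α²), and (ii) the Euler–Lagrange identity holds: ∂L₂/∂x(x,v) − v·∂²L₂/∂x∂v(x,v) − F₁(x,v)·∂²L₂/∂v²(x,v) = 0. Hence L₂ is a regular Lagrangian for the first nonlinear oscillator on U, associated with the Jacobi multiplier μ₂ = 1/(kv² − α²). -/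
/-- The inverse hyperbolic tangent. -/
noncomputable def artanh (x : ℝ) : ℝ := (1 / 2) * Real.log ((1 + x) / (1 - x))

theorem hasDerivAt_artanh {x : ℝ} (h₁ : -1 < x) (h₂ : x < 1) :
    HasDerivAt artanh (1 / (1 - x ^ 2)) x := by
  have hp : 1 + x ≠ 0 := by linarith
  have hm : 1 - x ≠ 0 := by linarith
  have hsq : 1 - x ^ 2 ≠ 0 := by
    rw [show 1 - x ^ 2 = (1 + x) * (1 - x) by ring]
    exact mul_ne_zero hp hm
  have h := (((((hasDerivAt_id x).const_add 1).fun_div ((hasDerivAt_id x).const_sub 1) hm).log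
    (div_ne_zero hp hm)).const_mul (1 / 2))
  refine h.congr_deriv ?_
  simp only [id]
  field_simp
  ring

theorem hasDerivAt_artanh_scaled {s α v : ℝ} (hs : 0 < s) (hα : 0 < α) (hv : s * |v| < α) :
    HasDerivAt (fun w => artanh (s * w / α)) (s * α / (α ^ 2 - s ^ 2 * v ^ 2)) v := by
  obtain ⟨hl, hr⟩ := abs_lt.mp (show |s * v| < α by rwa [abs_mul, abs_of_pos hs])
  have hlin : HasDerivAt (fun w : ℝ => s * w / α) (s / α) v := by
    simpa using ((hasDerivAt_id v).const_mul s).div_const α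
  have hl' : -1 < s * v / α := by rw [lt_div_iff₀ hα]; linarith
  have hr' : s * v / α < 1 := by rwa [div_lt_one hα]
  have h : HasDerivAt (fun w => artanh (s * w / α)) (1 / (1 - (s * v / α) ^ 2) * (s / α)) v :=
    HasDerivAt.comp (h₂ := artanh) (h := fun w => s * w / α) v (hasDerivAt_artanh hl' hr') hlin
  refine h.congr_deriv ?_
  rw [show 1 - (s * v / α) ^ 2 = (α ^ 2 - s ^ 2 * v ^ 2) / α ^ 2 by field_simp]
  field_simp

/-- The momentum `∂L₂/∂v` of the Lagrangian `L₂`, written with `s = √k`. -/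
theorem hasDerivAt_lagrangian_velocity {s α : ℝ} (hs : 0 < s) (hα : 0 < α) (x : ℝ) {v : ℝ}
    (hv : s * |v| < α) :
    HasDerivAt (fun w => -(w / (s * α)) * artanh (s * w / α)
        + (1 / (2 * s ^ 2)) * Real.log ((1 + s ^ 2 * x ^ 2) / (α ^ 2 - s ^ 2 * w ^ 2)))
      (-(1 / (s * α)) * artanh (s * v / α)) v := by
  obtain ⟨hl, hr⟩ := abs_lt.mp (show |s * v| < α by rwa [abs_mul, abs_of_pos hs])
  have hD : 0 < α ^ 2 - s ^ 2 * v ^ 2 := by nlinarith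
  have hx : 1 + s ^ 2 * x ^ 2 ≠ 0 := by positivity
  have hA := hasDerivAt_artanh_scaled hs hα hv
  have hden : HasDerivAt (fun w : ℝ => α ^ 2 - s ^ 2 * w ^ 2) (-(s ^ 2 * (2 * v))) v := by
    simpa using ((hasDerivAt_pow 2 v).const_mul (s ^ 2)).const_sub (α ^ 2)
  have hlog := (((hasDerivAt_const v (1 + s ^ 2 * x ^ 2)).fun_div hden hD.ne').log
    (div_ne_zero hx hD.ne')).const_mul (1 / (2 * s ^ 2))
  have hlin : HasDerivAt (fun w : ℝ => -(w / (s * α))) (-(1 / (s * α))) v :=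
    ((hasDerivAt_id v).div_const (s * α)).neg
  refine ((hlin.fun_mul hA).fun_add hlog).congr_deriv ?_
  have hD' := hD.ne'
  field_simp
  ring

/-- For `k > 0`, `α > 0`, on the open set `U = {(x,v) : √k·|v| < α}`,
the non-mechanical Lagrangian
`L₂(x,v) = −(v/(√k α))·artanh(√k v/α) + (1/(2k))·log((1+kx²)/(α² − kv²))`
satisfies `∂²L₂/∂v² = 1/(kv² − α²)` and the Euler–Lagrange identity for the first
nonlinear oscillator `ẍ = F₁(x,ẋ)`, `F₁(x,v) = x(kv² − α²)/(1+kx²)`; hence it is a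
regular Lagrangian on `U` associated with the Jacobi multiplier `μ₂ = 1/(kv² − α²)`. -/
theorem lagrangian_L2_first_oscillator
    (k α : ℝ) (hk : 0 < k) (hα : 0 < α) (F₁ L₂ : ℝ → ℝ → ℝ)
    (hF : ∀ x v : ℝ, F₁ x v = x * (k * v ^ 2 - α ^ 2) / (1 + k * x ^ 2))
    (hL : ∀ x v : ℝ, L₂ x v =
      -(v / (Real.sqrt k * α)) * artanh (Real.sqrt k * v / α)
        + (1 / (2 * k)) * Real.log ((1 + k * x ^ 2) / (α ^ 2 - k * v ^ 2))) :
    ∀ x v : ℝ, Real.sqrt k * |v| < α →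
      deriv (deriv (L₂ x)) v = 1 / (k * v ^ 2 - α ^ 2) ∧
      deriv (fun x' => L₂ x' v) x - v * deriv (fun x' => deriv (L₂ x') v) x
        - F₁ x v * deriv (deriv (L₂ x)) v = 0 := by
  obtain ⟨s, hs, rfl⟩ : ∃ s : ℝ, 0 < s ∧ k = s ^ 2 :=
    ⟨√k, Real.sqrt_pos.mpr hk, (Real.sq_sqrt hk.le).symm⟩
  simp only [Real.sqrt_sq hs.le] at hL ⊢
  intro x v hv
  obtain ⟨hl, hr⟩ := abs_lt.mp (show |s * v| < α by rwa [abs_mul, abs_of_pos hs])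
  have hD : α ^ 2 - s ^ 2 * v ^ 2 ≠ 0 := ne_of_gt (by nlinarith)
  have hD' : s ^ 2 * v ^ 2 - α ^ 2 ≠ 0 := by rwa [← neg_sub, neg_ne_zero]
  have hx : 1 + s ^ 2 * x ^ 2 ≠ 0 := by positivity
  have hmom : ∀ y w : ℝ, s * |w| < α →
      deriv (L₂ y) w = -(1 / (s * α)) * artanh (s * w / α) := by
    intro y w hw
    rw [funext (hL y)]
    exact (hasDerivAt_lagrangian_velocity hs hα y hw).deriv
  have hvv : deriv (deriv (L₂ x)) v = 1 / (s ^ 2 * v ^ 2 - α ^ 2) := by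
    have hev : deriv (L₂ x) =ᶠ[nhds v] fun w => -(1 / (s * α)) * artanh (s * w / α) := by
      have hopen : IsOpen {w : ℝ | s * |w| < α} :=
        isOpen_lt (by fun_prop) continuous_const
      filter_upwards [hopen.mem_nhds hv] with w hw using hmom x w hw
    rw [hev.deriv_eq]
    rw [((hasDerivAt_artanh_scaled hs hα hv).const_mul (-(1 / (s * α)))).deriv, ← neg_sub (α ^ 2)]
    field_simp
  have hpos : deriv (fun y => L₂ y v) x = x / (1 + s ^ 2 * x ^ 2) := by
    have hnum : HasDerivAt (fun y : ℝ => 1 + s ^ 2 * y ^ 2) (s ^ 2 * (2 * x)) x := by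
      simpa using ((hasDerivAt_pow 2 x).const_mul (s ^ 2)).const_add 1
    have h := (((hnum.div_const (α ^ 2 - s ^ 2 * v ^ 2)).log
      (div_ne_zero hx hD)).const_mul (1 / (2 * s ^ 2))).const_add
        (-(v / (s * α)) * artanh (s * v / α))
    simp only [hL]
    refine h.deriv.trans ?_
    field_simp
  have hmix : deriv (fun y => deriv (L₂ y) v) x = 0 := by
    simp only [hmom _ v hv, deriv_const]
  refine ⟨hvv, ?_⟩
  rw [hvv, hpos, hmix, hF]
  field_simp
  ring
end

section
/- Fix k ≥ 0 and α ∈ ℝ. Let x: ℝ → ℝ be twice differentiable and satisfy the second nonlinear oscillator equation ẍ(t) = −kx(t)ẋ(t)²/(1 + kx(t)²) − α²x(t)/(1 + kx(t)²)³ for all t ∈ ℝ. Then the function t ↦ I(t) = (k(1 + kx(t)²)²·ẋ(t)² − α²)/(1 + kx(t)²) is constant on ℝ; i.e. I = (k(1+kx²)²v² − α²)/(1+kx²) is a constant of motion for the second nonlinear oscillator. -/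
/-- Along any twice differentiable solution of the second nonlinear
oscillator `ẍ = −kxẋ²/(1+kx²) − α²x/(1+kx²)³`, the quantity
`I = (k(1+kx²)²ẋ² − α²)/(1+kx²)` is constant. -/
theorem constant_of_motion_second_oscillator
    (k α : ℝ) (hk : 0 ≤ k) (x x' x'' : ℝ → ℝ)
    (hx : ∀ t : ℝ, HasDerivAt x (x' t) t)
    (hx' : ∀ t : ℝ, HasDerivAt x' (x'' t) t)
    (heq : ∀ t : ℝ, x'' t =
      -(k * x t * x' t ^ 2 / (1 + k * x t ^ 2))
        - α ^ 2 * x t / (1 + k * x t ^ 2) ^ 3) :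
    ∀ t s : ℝ,
      (k * (1 + k * x t ^ 2) ^ 2 * x' t ^ 2 - α ^ 2) / (1 + k * x t ^ 2)
        = (k * (1 + k * x s ^ 2) ^ 2 * x' s ^ 2 - α ^ 2) / (1 + k * x s ^ 2) := by
  have hI : ∀ t : ℝ, HasDerivAt (fun t =>
      (k * (1 + k * x t ^ 2) ^ 2 * x' t ^ 2 - α ^ 2) / (1 + k * x t ^ 2)) 0 t := by
    intro t
    have hW : 1 + k * x t ^ 2 ≠ 0 := by positivity
    have hdW := (((hx t).fun_pow 2).const_mul k).const_add 1
    have hd := ((((hdW.fun_pow 2).const_mul k).fun_mul ((hx' t).fun_pow 2)).sub_const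
      (α ^ 2)).fun_div hdW hW
    refine hd.congr_deriv ?_
    rw [heq t]
    push_cast
    field_simp
    ring
  exact is_const_of_deriv_eq_zero (fun t => (hI t).differentiableAt) fun t => (hI t).deriv
end

section
/- Fix k ≥ 0 and α ∈ ℝ, and let F₂(x,v) = −kxv²/(1 + kx²) − α²x/(1 + kx²)³. The function L₁(x,v) = (1/2)(1 + kx²)v² − (1/2)·α²x²/(1 + kx²) is a regular Lagrangian for the second nonlinear oscillator: for all (x,v) ∈ ℝ², ∂L₁/∂x(x,v) − v·∂²L₁/∂x∂v(x,v) − F₂(x,v)·∂²L₁/∂v²(x,v) = 0, and ∂²L₁/∂v²(x,v) = 1 + kx² is nowhere zero. -/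
/-- `L₁(x,v) = ½(1+kx²)v² − ½α²x²/(1+kx²)` is a regular Lagrangian
for the second nonlinear oscillator `ẍ = F₂(x,ẋ)`,
`F₂(x,v) = −kxv²/(1+kx²) − α²x/(1+kx²)³`, `k ≥ 0`: the Euler–Lagrange identity
holds and `∂²L₁/∂v² = 1 + kx²` is nowhere zero. -/
theorem lagrangian_L1_second_oscillator
    (k α : ℝ) (hk : 0 ≤ k) (F₂ L₁ : ℝ → ℝ → ℝ)
    (hF : ∀ x v : ℝ, F₂ x v =
      -(k * x * v ^ 2 / (1 + k * x ^ 2)) - α ^ 2 * x / (1 + k * x ^ 2) ^ 3)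
    (hL : ∀ x v : ℝ, L₁ x v =
      (1 / 2) * (1 + k * x ^ 2) * v ^ 2
        - (1 / 2) * (α ^ 2 * x ^ 2 / (1 + k * x ^ 2))) :
    ∀ x v : ℝ,
      (deriv (fun x' => L₁ x' v) x - v * deriv (fun x' => deriv (L₁ x') v) x
        - F₂ x v * deriv (deriv (L₁ x)) v = 0)
      ∧ deriv (deriv (L₁ x)) v = 1 + k * x ^ 2
      ∧ (1 + k * x ^ 2 : ℝ) ≠ 0 := by
  have pos : ∀ x : ℝ, (1 + k * x ^ 2 : ℝ) ≠ 0 := fun x => by positivity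
  have hLv : ∀ x v : ℝ, deriv (L₁ x) v = (1 + k * x ^ 2) * v := fun x v => by
    rw [funext (hL x)]
    refine HasDerivAt.deriv ?_
    convert (((hasDerivAt_id' v).pow 2).const_mul ((1 / 2) * (1 + k * x ^ 2))).sub_const
      ((1 / 2) * (α ^ 2 * x ^ 2 / (1 + k * x ^ 2))) using 1
    norm_num
    ring
  have hLvv : ∀ x v : ℝ, deriv (deriv (L₁ x)) v = 1 + k * x ^ 2 := fun x v => by
    rw [funext (hLv x)]
    simp
  have hw : ∀ x : ℝ, HasDerivAt (fun y : ℝ => 1 + k * y ^ 2) (2 * k * x) x := fun x => by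
    refine ((((hasDerivAt_id' x).fun_pow 2).const_mul k).const_add 1).congr_deriv ?_
    norm_num
    ring
  have hLxv : ∀ x v : ℝ, deriv (fun x' => deriv (L₁ x') v) x = 2 * k * x * v := fun x v => by
    simp only [hLv]
    exact ((hw x).mul_const v).deriv
  have hLx : ∀ x v : ℝ, deriv (fun x' => L₁ x' v) x =
      k * x * v ^ 2 - α ^ 2 * x / (1 + k * x ^ 2) ^ 2 := fun x v => by
    simp only [hL]
    have hd := (((hw x).const_mul (1 / 2)).mul_const (v ^ 2)).sub
      (((((hasDerivAt_id' x).fun_pow 2).const_mul (α ^ 2)).fun_div (hw x) (pos x)).const_mul (1 / 2))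
    refine hd.deriv.trans ?_
    have := pos x
    norm_num
    field_simp
    ring
  intro x v
  refine ⟨?_, hLvv x v, pos x⟩
  rw [hLx, hLxv, hLvv, hF]
  have := pos x
  field_simp
  ring
end

section
/- Let F: ℝ² → ℝ and h: ℝ → ℝ be smooth, and set H(x,v) = F(x,v)·h(v). On ℝ⁴ with coordinates (t,x,v,w), define the smooth vector fields X(t,x,v,w) = (0, v, F(x,v), H(x,v)) and X̄ = ∂/∂t + X, i.e. X̄(t,x,v,w) = (1, v, F(x,v), H(x,v)). Let g: ℝ⁴ → ℝ be a smooth function that is independent of t and x (∂g/∂t = ∂g/∂x ≡ 0) and satisfies ∂g/∂v(t,x,v,w) + h(v)·∂g/∂w(t,x,v,w) = 0 at every point. Then the Lie bracket of vector fields [g·X, X̄] vanishes identically on ℝ⁴ (where [V,W](p) = DW(p)·V(p) − DV(p)·W(p)). In particular Y = g·X is an infinitesimal symmetry of the one-dimensional distribution spanned by X̄, hence yields a non-local symmetry of the ODE ẍ = F(x,ẋ). -/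
/-- The derivative of `f` along a curve `c` with velocity `e` is `fderiv ℝ f (c s) e`. -/
theorem fderiv_apply_eq_deriv_comp {E G : Type*} [NormedAddCommGroup E] [NormedSpace ℝ E]
    [NormedAddCommGroup G] [NormedSpace ℝ G] {f : E → G} {c : ℝ → E} {e : E} {s : ℝ}
    (hf : DifferentiableAt ℝ f (c s)) (hc : HasDerivAt c e s) :
    fderiv ℝ f (c s) e = deriv (fun s' => f (c s')) s :=
  (hf.hasFDerivAt.comp_hasDerivAt s hc).deriv.symm

/-- Extended-system construction of non-local symmetries. With
`H(x,v) = F(x,v)h(v)`, on `ℝ⁴` with coordinates `(t,x,v,w)` consider the vector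
fields `X = (0, v, F, H)` and `X̄ = ∂/∂t + X = (1, v, F, H)`. If `g : ℝ⁴ → ℝ` is
smooth, independent of `t` and `x`, and satisfies `∂g/∂v + h(v)·∂g/∂w = 0`, then
the Lie bracket `[g·X, X̄]` vanishes identically, so `Y = g·X` is an infinitesimal
symmetry of the distribution spanned by `X̄`, i.e. a non-local symmetry of
`ẍ = F(x,ẋ)`. -/
theorem nonlocal_symmetry_extended_system
    (F : ℝ → ℝ → ℝ) (h : ℝ → ℝ) (H : ℝ → ℝ → ℝ)
    (hF : ContDiff ℝ (⊤ : ℕ∞) (fun p : ℝ × ℝ => F p.1 p.2))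
    (hh : ContDiff ℝ (⊤ : ℕ∞) h)
    (hH : ∀ x v : ℝ, H x v = F x v * h v)
    (X Xbar : ℝ × ℝ × ℝ × ℝ → ℝ × ℝ × ℝ × ℝ)
    (hX : ∀ p : ℝ × ℝ × ℝ × ℝ,
      X p = (0, p.2.2.1, F p.2.1 p.2.2.1, H p.2.1 p.2.2.1))
    (hXbar : ∀ p : ℝ × ℝ × ℝ × ℝ,
      Xbar p = (1, p.2.2.1, F p.2.1 p.2.2.1, H p.2.1 p.2.2.1))
    (g : ℝ × ℝ × ℝ × ℝ → ℝ)
    (hg : ContDiff ℝ (⊤ : ℕ∞) g)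
    (hgt : ∀ t x v w : ℝ, deriv (fun t' => g (t', x, v, w)) t = 0)
    (hgx : ∀ t x v w : ℝ, deriv (fun x' => g (t, x', v, w)) x = 0)
    (hgvw : ∀ t x v w : ℝ,
      deriv (fun v' => g (t, x, v', w)) v
        + h v * deriv (fun w' => g (t, x, v, w')) w = 0) :
    ∀ p : ℝ × ℝ × ℝ × ℝ,
      fderiv ℝ Xbar p (g p • X p)
        - fderiv ℝ (fun q => g q • X q) p (Xbar p) = 0 := by
  rintro ⟨t, x, v, w⟩
  have hgd : DifferentiableAt ℝ g (t, x, v, w) := hg.differentiable (by simp) _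
  have hFd : Differentiable ℝ (fun p : ℝ × ℝ => F p.1 p.2) := hF.differentiable (by simp)
  have hhd : Differentiable ℝ h := hh.differentiable (by simp)
  have hXd : Differentiable ℝ X := by
    have hXeq : X = fun p => (0, p.2.2.1, F p.2.1 p.2.2.1, F p.2.1 p.2.2.1 * h p.2.2.1) := by
      funext p
      rw [hX, hH]
    have hF' : Differentiable ℝ (fun p : ℝ × ℝ × ℝ × ℝ => F p.2.1 p.2.2.1) :=
      hFd.comp (g := fun p : ℝ × ℝ => F p.1 p.2)
        (f := fun p : ℝ × ℝ × ℝ × ℝ => (p.2.1, p.2.2.1)) (by fun_prop)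
    rw [hXeq]
    fun_prop
  have hXbarX : Xbar = fun p => X p + (1, 0, 0, 0) := by
    funext p
    simp [hX, hXbar]
  have ht : HasDerivAt (fun s : ℝ => (s, x, v, w)) (1, 0, 0, 0) t :=
    (hasDerivAt_id t).prodMk (hasDerivAt_const t (x, v, w))
  have hx : HasDerivAt (fun s : ℝ => (t, s, v, w)) (0, 1, 0, 0) x :=
    (hasDerivAt_const x t).prodMk ((hasDerivAt_id x).prodMk (hasDerivAt_const x (v, w)))
  have hv : HasDerivAt (fun s : ℝ => (t, x, s, w)) (0, 0, 1, 0) v :=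
    (hasDerivAt_const v t).prodMk
      ((hasDerivAt_const v x).prodMk ((hasDerivAt_id v).prodMk (hasDerivAt_const v w)))
  have hw : HasDerivAt (fun s : ℝ => (t, x, v, s)) (0, 0, 0, 1) w :=
    (hasDerivAt_const w t).prodMk
      ((hasDerivAt_const w x).prodMk ((hasDerivAt_const w v).prodMk (hasDerivAt_id w)))
  have hXt : fderiv ℝ X (t, x, v, w) (1, 0, 0, 0) = 0 := by
    rw [fderiv_apply_eq_deriv_comp (hXd _) ht]
    simp [hX]
  have hgXbar : fderiv ℝ g (t, x, v, w) (X (t, x, v, w) + (1, 0, 0, 0)) = 0 := by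
    have hdecomp : X (t, x, v, w) + (1, 0, 0, 0) =
        (1, 0, 0, 0) + v • ((0, 1, 0, 0) : ℝ × ℝ × ℝ × ℝ)
          + F x v • ((0, 0, 1, 0) : ℝ × ℝ × ℝ × ℝ)
          + (F x v * h v) • ((0, 0, 0, 1) : ℝ × ℝ × ℝ × ℝ) := by
      simp [hX, hH]
    rw [hdecomp, map_add, map_add, map_add, map_smul, map_smul, map_smul,
      fderiv_apply_eq_deriv_comp hgd ht, fderiv_apply_eq_deriv_comp hgd hx,
      fderiv_apply_eq_deriv_comp hgd hv, fderiv_apply_eq_deriv_comp hgd hw,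
      hgt, hgx, smul_eq_mul, smul_eq_mul, smul_eq_mul]
    linear_combination F x v * hgvw t x v w
  rw [hXbarX, fderiv_add_const, fderiv_fun_smul hgd (hXd _)]
  simp only [add_apply, smul_apply, ContinuousLinearMap.smulRight_apply, hgXbar]
  rw [map_add, hXt, map_smul, zero_smul, add_zero, add_zero, sub_self]
end

section
/- Fix k ≥ 0 and α ∈ ℝ, let F₁(x,v) = x(kv² − α²)/(1 + kx²) and H(x,v) = F₁(x,v)/v. On the open set M = {(x,v,w) ∈ ℝ³ : v ≠ 0} define the vector fields X_H(x,v,w) = (v, F₁(x,v), H(x,v)) and Y(x,v,w) = eʷ·(1, H(x,v), H(x,v)/v). Then: (i) the function g(x,v,w) = eʷ/v satisfies X_H g = 0 on M, i.e. v·∂g/∂x + F₁·∂g/∂v + H·∂g/∂w = 0 there; (ii) Y = g·X_H, and the Lie bracket [Y, X_H] vanishes identically on M (where [V,W](p) = DW(p)·V(p) − DV(p)·W(p)). Hence Y is a non-local symmetry of the first nonlinear oscillator. -/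
/-- If `Y` agrees near `p` with `g • V`, where `g` is a first integral of `V` at `p`,
then `Y` commutes with `V` at `p`. -/
theorem lie_bracket_eq_zero_of_eventuallyEq_smul
    {E : Type*} [NormedAddCommGroup E] [NormedSpace ℝ E] {V Y : E → E} {g : E → ℝ} {p : E}
    (hV : DifferentiableAt ℝ V p) (hg : DifferentiableAt ℝ g p)
    (hY : Y =ᶠ[nhds p] fun q => g q • V q) (h : fderiv ℝ g p (V p) = 0) :
    fderiv ℝ V p (Y p) - fderiv ℝ Y p (V p) = 0 := by
  rw [hY.fderiv_eq, hY.eq_of_nhds, fderiv_fun_smul hg hV]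
  simp [h]

/-- The derivative of `eʷ / v` at a point with `v ≠ 0`. -/
theorem hasFDerivAt_exp_div (p : ℝ × ℝ × ℝ) (hp : p.2.1 ≠ 0) :
    HasFDerivAt (fun q : ℝ × ℝ × ℝ => Real.exp q.2.2 / q.2.1)
      ((Real.exp p.2.2 / p.2.1) •
          (ContinuousLinearMap.snd ℝ ℝ ℝ ∘L ContinuousLinearMap.snd ℝ ℝ (ℝ × ℝ))
        - (Real.exp p.2.2 / p.2.1 ^ 2) •
          (ContinuousLinearMap.fst ℝ ℝ ℝ ∘L ContinuousLinearMap.snd ℝ ℝ (ℝ × ℝ))) p := by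
  have hw : HasFDerivAt (fun q : ℝ × ℝ × ℝ => q.2.2)
      (ContinuousLinearMap.snd ℝ ℝ ℝ ∘L ContinuousLinearMap.snd ℝ ℝ (ℝ × ℝ)) p :=
    (ContinuousLinearMap.snd ℝ ℝ ℝ ∘L ContinuousLinearMap.snd ℝ ℝ (ℝ × ℝ)).hasFDerivAt
  have hv : HasFDerivAt (fun q : ℝ × ℝ × ℝ => q.2.1)
      (ContinuousLinearMap.fst ℝ ℝ ℝ ∘L ContinuousLinearMap.snd ℝ ℝ (ℝ × ℝ)) p :=
    (ContinuousLinearMap.fst ℝ ℝ ℝ ∘L ContinuousLinearMap.snd ℝ ℝ (ℝ × ℝ)).hasFDerivAt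
  simp only [div_eq_mul_inv]
  refine (hw.exp.mul ((hasDerivAt_inv hp).comp_hasFDerivAt p hv)).congr_fderiv ?_
  ext <;> simp [mul_comm]

/-- Non-local symmetry of the first nonlinear oscillator. With
`F₁(x,v) = x(kv² − α²)/(1+kx²)`, `H = F₁/v`, on `M = {(x,v,w) : v ≠ 0} ⊂ ℝ³`
consider `X_H = (v, F₁, H)` and `Y = eʷ·(1, H, H/v)`. Then `g(x,v,w) = eʷ/v`
satisfies `X_H g = 0` on `M`, `Y = g·X_H` on `M`, and the Lie bracket `[Y, X_H]`
vanishes identically on `M`; hence `Y` is a non-local symmetry of the first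
nonlinear oscillator. -/
theorem nonlocal_symmetry_first_oscillator
    (k α : ℝ) (hk : 0 ≤ k) (F₁ H : ℝ → ℝ → ℝ)
    (hF : ∀ x v : ℝ, F₁ x v = x * (k * v ^ 2 - α ^ 2) / (1 + k * x ^ 2))
    (hH : ∀ x v : ℝ, H x v = F₁ x v / v)
    (XH Y : ℝ × ℝ × ℝ → ℝ × ℝ × ℝ)
    (hXH : ∀ p : ℝ × ℝ × ℝ, XH p = (p.2.1, F₁ p.1 p.2.1, H p.1 p.2.1))
    (hY : ∀ p : ℝ × ℝ × ℝ,
      Y p = Real.exp p.2.2 • ((1 : ℝ), H p.1 p.2.1, H p.1 p.2.1 / p.2.1))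
    (g : ℝ × ℝ × ℝ → ℝ)
    (hg : ∀ p : ℝ × ℝ × ℝ, g p = Real.exp p.2.2 / p.2.1) :
    (∀ x v w : ℝ, v ≠ 0 →
      v * deriv (fun x' => g (x', v, w)) x
        + F₁ x v * deriv (fun v' => g (x, v', w)) v
        + H x v * deriv (fun w' => g (x, v, w')) w = 0)
    ∧ (∀ p : ℝ × ℝ × ℝ, p.2.1 ≠ 0 → Y p = g p • XH p)
    ∧ (∀ p : ℝ × ℝ × ℝ, p.2.1 ≠ 0 →
        fderiv ℝ XH p (Y p) - fderiv ℝ Y p (XH p) = 0) := by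
  obtain rfl : g = fun p : ℝ × ℝ × ℝ => Real.exp p.2.2 / p.2.1 := funext hg
  have hYg : ∀ p : ℝ × ℝ × ℝ, p.2.1 ≠ 0 → Y p = (Real.exp p.2.2 / p.2.1) • XH p := by
    intro p hp
    rw [hY, hXH]
    ext <;> simp [hH] <;> field_simp
  refine ⟨fun x v w hv => ?_, hYg, fun p hp => ?_⟩
  · have hdv : deriv (fun v' => Real.exp w / v') v = -(Real.exp w / v ^ 2) := by
      simp [div_eq_mul_inv]
    have hdw : deriv (fun w' => Real.exp w' / v) w = Real.exp w / v :=
      ((Real.hasDerivAt_exp w).div_const v).deriv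
    simp only [deriv_const, hdv, hdw, hH]
    field_simp
    ring
  · have hden : 1 + k * p.1 ^ 2 ≠ 0 := by positivity
    have hX : DifferentiableAt ℝ XH p := by
      rw [funext hXH]
      simp only [hH, hF]
      fun_prop (disch := assumption)
    have hgp := hasFDerivAt_exp_div p hp
    refine lie_bracket_eq_zero_of_eventuallyEq_smul hX hgp.differentiableAt ?_ ?_
    · have hv : ContinuousAt (fun q : ℝ × ℝ × ℝ => q.2.1) p := by fun_prop
      filter_upwards [hv.eventually_ne hp] with q hq using hYg q hq
    · rw [hgp.fderiv, hXH]
      simp [hH]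
      field_simp
      ring
end
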